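/- Let n ≥ 1, let U ⊆ EuclideanSpace ℝ n be open, let f : EuclideanSpace ℝ n → ℝ be differentiable on U, let p ∈ U be a non-critical point of f (gradient f p ≠ 0), let W ∈ EuclideanSpace ℝ n with ‖W‖ < 1, and let F be the Zermelo–Randers norm with wind W. If v ≠ 0 is a Finsler gradient of f at p with respect to F, then (‖gradient f p‖ / F(v)) • (v − F(v) • W) = gradient f p, where gradient f p denotes the Euclidean (Riemannian) gradient of f at p. -/

import Mathlib

open RealInnerProductSpace

/-- The Zermelo–Randers norm with wind `W`:
`F(y) = (√(⟪W,y⟫² + λ‖y‖²) − ⟪W,y⟫)/λ` with `λ = 1 − ‖W‖²`.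
(The formula also gives `F 0 = 0`.) -/
noncomputable def zermeloRanders {n : ℕ} (W : EuclideanSpace ℝ (Fin n))
    (y : EuclideanSpace ℝ (Fin n)) : ℝ :=
  (Real.sqrt (⟪W, y⟫ ^ 2 + (1 - ‖W‖ ^ 2) * ‖y‖ ^ 2) - ⟪W, y⟫) / (1 - ‖W‖ ^ 2)

section ZermeloRanders

variable {n : ℕ} {W v : EuclideanSpace ℝ (Fin n)}

theorem one_sub_norm_sq_pos (hW : ‖W‖ < 1) : 0 < 1 - ‖W‖ ^ 2 := by
  nlinarith [norm_nonneg W]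

theorem zermeloRanders_radicand_pos (hW : ‖W‖ < 1) (hv : v ≠ 0) :
    0 < ⟪W, v⟫ ^ 2 + (1 - ‖W‖ ^ 2) * ‖v‖ ^ 2 := by
  have := one_sub_norm_sq_pos hW
  have := norm_pos_iff.2 hv
  positivity

theorem zermeloRanders_pos (hW : ‖W‖ < 1) (hv : v ≠ 0) : 0 < zermeloRanders W v := by
  have hl := one_sub_norm_sq_pos hW
  have hv' := norm_pos_iff.2 hv
  refine div_pos (sub_pos.2 (Real.lt_sqrt_of_sq_lt ?_)) hl
  have : 0 < (1 - ‖W‖ ^ 2) * ‖v‖ ^ 2 := by positivity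
  linarith

theorem sqrt_eq_mul_zermeloRanders_add_inner (hW : ‖W‖ < 1) :
    Real.sqrt (⟪W, v⟫ ^ 2 + (1 - ‖W‖ ^ 2) * ‖v‖ ^ 2) =
      (1 - ‖W‖ ^ 2) * zermeloRanders W v + ⟪W, v⟫ := by
  have := (one_sub_norm_sq_pos hW).ne'
  unfold zermeloRanders
  field_simp
  ring

/-- The indicatrix of the Zermelo–Randers norm is the unit sphere translated by the wind. -/
theorem norm_sub_zermeloRanders_smul (hW : ‖W‖ < 1) (hv : v ≠ 0) :
    ‖v - zermeloRanders W v • W‖ = zermeloRanders W v := by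
  have hl := one_sub_norm_sq_pos hW
  have hsq := Real.sq_sqrt (zermeloRanders_radicand_pos hW hv).le
  rw [sqrt_eq_mul_zermeloRanders_add_inner hW] at hsq
  have hF := zermeloRanders_pos hW hv
  rw [← sq_eq_sq₀ (norm_nonneg _) hF.le, norm_sub_sq_real, inner_smul_right, norm_smul,
    real_inner_comm, Real.norm_of_nonneg hF.le]
  apply mul_left_cancel₀ hl.ne'
  linear_combination -hsq

theorem hasDerivAt_zermeloRanders_line (hW : ‖W‖ < 1) (hv : v ≠ 0)
    (u : EuclideanSpace ℝ (Fin n)) :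
    HasDerivAt (fun s : ℝ => zermeloRanders W (v + s • u))
      (⟪v - zermeloRanders W v • W, u⟫ /
        Real.sqrt (⟪W, v⟫ ^ 2 + (1 - ‖W‖ ^ 2) * ‖v‖ ^ 2)) 0 := by
  have hl := (one_sub_norm_sq_pos hW).ne'
  have hR := Real.sqrt_pos.2 (zermeloRanders_radicand_pos hW hv)
  have hline : HasDerivAt (fun s : ℝ => v + s • u) u 0 := by
    simpa using ((hasDerivAt_id (0 : ℝ)).smul_const u).const_add v
  have hinner : HasDerivAt (fun s : ℝ => ⟪W, v + s • u⟫) ⟪W, u⟫ 0 := by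
    simpa using (hasDerivAt_const (0 : ℝ) W).inner ℝ hline
  have hnorm : HasDerivAt (fun s : ℝ => ‖v + s • u‖ ^ 2) (2 * ⟪v, u⟫) 0 := by
    simpa using hline.norm_sq
  have hrad := (hinner.pow 2).add (hnorm.const_mul (1 - ‖W‖ ^ 2))
  have hsqrt := hrad.sqrt (by simpa using (zermeloRanders_radicand_pos hW hv).ne')
  refine ((hsqrt.sub hinner).div_const (1 - ‖W‖ ^ 2)).congr_deriv ?_
  have hReq := sqrt_eq_mul_zermeloRanders_add_inner (v := v) hW
  simp only [Pi.add_apply, Pi.pow_apply, zero_smul, add_zero, inner_sub_left,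
    real_inner_smul_left]
  generalize Real.sqrt (⟪W, v⟫ ^ 2 + (1 - ‖W‖ ^ 2) * ‖v‖ ^ 2) = R at *
  have hR' := hR.ne'
  field_simp
  push_cast
  linear_combination (-2 * ⟪W, u⟫) * hReq

end ZermeloRanders

/-- Lemma relating Finsler and Riemannian gradients, item (i).
If `v ≠ 0` is a Finsler gradient of `f` at a non-critical point `p` with respect to the
Zermelo–Randers norm with wind `W`, then
`(‖∇̃f(p)‖ / F(v)) • (v − F(v) • W) = ∇̃f(p)`, where `∇̃` is the Euclidean gradient. -/
theorem finsler_gradient_riemannian_gradient_relation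
    (n : ℕ) (hn : 1 ≤ n)
    (U : Set (EuclideanSpace ℝ (Fin n))) (hU : IsOpen U)
    (f : EuclideanSpace ℝ (Fin n) → ℝ) (hf : DifferentiableOn ℝ f U)
    (p : EuclideanSpace ℝ (Fin n)) (hp : p ∈ U)
    (hcrit : gradient f p ≠ 0)
    (W : EuclideanSpace ℝ (Fin n)) (hW : ‖W‖ < 1)
    (v : EuclideanSpace ℝ (Fin n)) (hv : v ≠ 0)
    (hFgrad : ∀ u, fderiv ℝ f p u =
      (1 / 2 : ℝ) * deriv (fun s : ℝ => (zermeloRanders W (v + s • u)) ^ 2) 0) :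
    (‖gradient f p‖ / zermeloRanders W v) • (v - zermeloRanders W v • W) = gradient f p := by
  have hR := Real.sqrt_pos.2 (zermeloRanders_radicand_pos hW hv)
  have hF := zermeloRanders_pos hW hv
  have hnorm := norm_sub_zermeloRanders_smul hW hv
  have hderiv := hasDerivAt_zermeloRanders_line hW hv
  generalize Real.sqrt (⟪W, v⟫ ^ 2 + (1 - ‖W‖ ^ 2) * ‖v‖ ^ 2) = R at *
  have hgrad : gradient f p =
      (zermeloRanders W v / R) • (v - zermeloRanders W v • W) := by
    refine ext_inner_right ℝ fun u => ?_
    rw [gradient, InnerProductSpace.toDual_symm_apply, hFgrad u,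
      ((hderiv u).fun_pow 2).deriv, real_inner_smul_left]
    simp only [zero_smul, add_zero]
    push_cast
    ring
  rw [hgrad, norm_smul, hnorm, Real.norm_of_nonneg (by positivity)]
  congr 1
  field_simp
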